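/- Let U_{AB→CD} be a bipartite unitary whose Choi state satisfies I₃(A;C;D) = −2 log₂|A| + ε for some ε ≥ 0, where |A| is the smallest of the four subsystem dimensions. Then I(A;D) ≤ ε and I(A;C) ≤ ε, and the reduced Choi state satisfies ‖ρ_{AD} − τ_A ⊗ τ_D‖₁ ≤ √(2 ln(2) ε), and likewise ‖ρ_{AC} − τ_A ⊗ τ_C‖₁ ≤ √(2 ln(2) ε). -/

import Mathlib

open Matrix Kronecker Filter
open scoped BigOperators Classical ComplexOrder

noncomputable section

namespace Scrambling

/-- The maximally mixed state on a finite-dimensional system `X`. -/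
def mmState (X : Type*) [Fintype X] [DecidableEq X] : Matrix X X ℂ :=
  (Fintype.card X : ℂ)⁻¹ • 1

/-- A (possibly rectangular) matrix is unitary if `U Uᴴ = 1` and `Uᴴ U = 1`. -/
def IsUnitaryMat {m n : Type*} [Fintype m] [Fintype n] [DecidableEq m] [DecidableEq n]
    (U : Matrix m n ℂ) : Prop :=
  U * Uᴴ = 1 ∧ Uᴴ * U = 1

/-- Reduced density matrix of a pure state `ψ` on `X ⊗ Y`, tracing out `Y`. -/
def redDM {X Y : Type*} [Fintype Y] (ψ : X × Y → ℂ) : Matrix X X ℂ :=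
  Matrix.of fun x x' => ∑ y, ψ (x, y) * star (ψ (x', y))

/-- Base-2 von Neumann entropy of a (Hermitian) matrix: `S(ρ) = -tr (ρ log₂ ρ)`,
computed via the eigenvalues. Junk value `0` for non-Hermitian matrices. -/
def vNE {n : Type*} [Fintype n] [DecidableEq n] (ρ : Matrix n n ℂ) : ℝ :=
  if h : ρ.IsHermitian then (∑ i, Real.negMulLog (h.eigenvalues i)) / Real.log 2 else 0

/-- Trace norm `‖X‖₁ = tr √(XᴴX)`, via the eigenvalues of `XᴴX`. -/
def traceNorm {n : Type*} [Fintype n] [DecidableEq n] (X : Matrix n n ℂ) : ℝ :=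
  ∑ i, Real.sqrt ((Matrix.posSemidef_conjTranspose_mul_self X).1.eigenvalues i)

/-- Density matrix: positive semidefinite with unit trace. -/
def IsDensityMatrix {n : Type*} [Fintype n] (ρ : Matrix n n ℂ) : Prop :=
  ρ.PosSemidef ∧ ρ.trace = 1

/-- The pure density matrix `|ψ⟩⟨ψ|` associated to a state vector. -/
def pureDM {T : Type*} (ψ : T → ℂ) : Matrix T T ℂ :=
  Matrix.of fun x y => ψ x * star (ψ y)

/-- Extension `id_R ⊗ Φ` of a (linear) map `Φ` on matrices to a reference system `R`. -/
def extendCh {R A C : Type*} (Φ : Matrix A A ℂ → Matrix C C ℂ)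
    (ρ : Matrix (R × A) (R × A) ℂ) : Matrix (R × C) (R × C) ℂ :=
  Matrix.of fun p q => Φ (Matrix.of fun x y => ρ (p.1, x) (q.1, y)) p.2 q.2

/-- Diamond-norm distance between two (linear) maps on matrices:
the supremum over all finite-dimensional reference systems `R = Fin n` and all density
matrices `ρ` on `R ⊗ A` of the trace norm of the difference of the extended outputs. -/
def diamondDist {A C : Type*} [Fintype A] [DecidableEq A] [Fintype C] [DecidableEq C]
    (Φ Ψ : Matrix A A ℂ → Matrix C C ℂ) : ℝ :=
  sSup {x | ∃ (n : ℕ) (ρ : Matrix (Fin n × A) (Fin n × A) ℂ),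
    IsDensityMatrix ρ ∧ x = traceNorm (extendCh Φ ρ - extendCh Ψ ρ)}

/-- The unitary quantum channel `σ ↦ U σ Uᴴ`. -/
def uChannel {m n : Type*} [Fintype m] [Fintype n] (U : Matrix m n ℂ) : Matrix n n ℂ → Matrix m m ℂ :=
  fun σ => U * σ * Uᴴ

/-- The completely depolarizing channel `σ ↦ tr(σ) · τ_C`. -/
def depol (A C : Type*) [Fintype A] [Fintype C] [DecidableEq C] :
    Matrix A A ℂ → Matrix C C ℂ :=
  fun σ => σ.trace • mmState C

section FourParty

variable {A B C D : Type*} [Fintype A] [Fintype B] [Fintype C] [Fintype D]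
  [DecidableEq A] [DecidableEq B] [DecidableEq C] [DecidableEq D]

/-- State vector of the Choi state of a bipartite unitary `U : AB → CD`:
`|U⟩ = (1 ⊗ U)(|Φ⁺⟩_{AA'} ⊗ |Φ⁺⟩_{BB'})`. -/
def choiVec (U : Matrix (C × D) (A × B) ℂ) : (A × B) × C × D → ℂ :=
  fun p => (Real.sqrt (Fintype.card A * Fintype.card B) : ℂ)⁻¹ * U p.2 p.1

/-- Density matrix of the Choi state of a bipartite unitary. -/
def choiDM (U : Matrix (C × D) (A × B) ℂ) :
    Matrix ((A × B) × C × D) ((A × B) × C × D) ℂ :=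
  pureDM (choiVec U)

variable (ψ : (A × B) × C × D → ℂ)

/-- Reduced density matrices of a four-party pure state on `A ⊗ B ⊗ C ⊗ D`. -/
def rhoA : Matrix A A ℂ :=
  redDM fun p : A × (B × C × D) => ψ ((p.1, p.2.1), (p.2.2.1, p.2.2.2))

def rhoB : Matrix B B ℂ :=
  redDM fun p : B × (A × C × D) => ψ ((p.2.1, p.1), (p.2.2.1, p.2.2.2))

def rhoC : Matrix C C ℂ :=
  redDM fun p : C × (A × B × D) => ψ ((p.2.1, p.2.2.1), (p.1, p.2.2.2))

def rhoD : Matrix D D ℂ :=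
  redDM fun p : D × (A × B × C) => ψ ((p.2.1, p.2.2.1), (p.2.2.2, p.1))

def rhoAB : Matrix (A × B) (A × B) ℂ := redDM ψ

def rhoAC : Matrix (A × C) (A × C) ℂ :=
  redDM fun p : (A × C) × B × D => ψ ((p.1.1, p.2.1), (p.1.2, p.2.2))

def rhoAD : Matrix (A × D) (A × D) ℂ :=
  redDM fun p : (A × D) × B × C => ψ ((p.1.1, p.2.1), (p.2.2, p.1.2))

def rhoBC : Matrix (B × C) (B × C) ℂ :=
  redDM fun p : (B × C) × A × D => ψ ((p.2.1, p.1.1), (p.1.2, p.2.2))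

def rhoBD : Matrix (B × D) (B × D) ℂ :=
  redDM fun p : (B × D) × A × C => ψ ((p.2.1, p.1.1), (p.2.2, p.1.2))

def rhoCD : Matrix (C × D) (C × D) ℂ :=
  redDM fun p : (C × D) × A × B => ψ (p.2, p.1)

def rhoABC : Matrix ((A × B) × C) ((A × B) × C) ℂ :=
  redDM fun p : ((A × B) × C) × D => ψ (p.1.1, (p.1.2, p.2))

def rhoABD : Matrix ((A × B) × D) ((A × B) × D) ℂ :=
  redDM fun p : ((A × B) × D) × C => ψ (p.1.1, (p.2, p.1.2))

def rhoACD : Matrix (A × C × D) (A × C × D) ℂ :=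
  redDM fun p : (A × C × D) × B => ψ ((p.1.1, p.2), p.1.2)

def rhoBCD : Matrix (B × C × D) (B × C × D) ℂ :=
  redDM fun p : (B × C × D) × A => ψ ((p.2, p.1.1), p.1.2)

/-- Subsystem von Neumann entropies. -/
def SA : ℝ := vNE (rhoA ψ)
def SB : ℝ := vNE (rhoB ψ)
def SC : ℝ := vNE (rhoC ψ)
def SD : ℝ := vNE (rhoD ψ)
def SAB : ℝ := vNE (rhoAB ψ)
def SAC : ℝ := vNE (rhoAC ψ)
def SAD : ℝ := vNE (rhoAD ψ)
def SBC : ℝ := vNE (rhoBC ψ)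
def SBD : ℝ := vNE (rhoBD ψ)
def SCD : ℝ := vNE (rhoCD ψ)
def SABC : ℝ := vNE (rhoABC ψ)
def SABD : ℝ := vNE (rhoABD ψ)
def SACD : ℝ := vNE (rhoACD ψ)
def SBCD : ℝ := vNE (rhoBCD ψ)

/-- Mutual informations `I(X;Y) = S(X) + S(Y) - S(XY)`. -/
def IAB : ℝ := SA ψ + SB ψ - SAB ψ
def IAC : ℝ := SA ψ + SC ψ - SAC ψ
def IAD : ℝ := SA ψ + SD ψ - SAD ψ
def IBC : ℝ := SB ψ + SC ψ - SBC ψ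
def IBD : ℝ := SB ψ + SD ψ - SBD ψ
def ICD : ℝ := SC ψ + SD ψ - SCD ψ
def IACD : ℝ := SA ψ + SCD ψ - SACD ψ

/-- Tripartite information `I₃(A;C;D) = I(A;C) + I(A;D) - I(A;CD)`. -/
def I3ACD : ℝ := IAC ψ + IAD ψ - IACD ψ

/-- Conditional mutual informations. -/
def cmiAB_C : ℝ := SAC ψ + SBC ψ - SC ψ - SABC ψ
def cmiAB_D : ℝ := SAD ψ + SBD ψ - SD ψ - SABD ψ
def cmiCD_A : ℝ := SAC ψ + SAD ψ - SA ψ - SACD ψ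
def cmiCD_B : ℝ := SBC ψ + SBD ψ - SB ψ - SBCD ψ

/-- Rényi-2 entropy `S₂(ρ) = -log₂ tr ρ²`. -/
def S2 {n : Type*} [Fintype n] (ρ : Matrix n n ℂ) : ℝ :=
  -Real.logb 2 ((ρ * ρ).trace.re)

/-- Rényi-2 tripartite information `I₃⁽²⁾ = S₂(A) + S₂(B) - S₂(AC) - S₂(AD)`. -/
def I3r2 : ℝ := S2 (rhoA ψ) + S2 (rhoB ψ) - S2 (rhoAC ψ) - S2 (rhoAD ψ)

end FourParty

/-- The residual channel `N_{A→C}(σ) = tr_D [U (σ ⊗ τ_B) Uᴴ]`. -/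
def residual {A B C D : Type*} [Fintype A] [Fintype B] [Fintype C] [Fintype D]
    [DecidableEq A] [DecidableEq B]
    (U : Matrix (C × D) (A × B) ℂ) (σ : Matrix A A ℂ) : Matrix C C ℂ :=
  Matrix.of fun c c' => ∑ d, (U * (σ ⊗ₖ mmState B) * Uᴴ) (c, d) (c', d)

/-- A unitary on `X ⊗ X` is a perfect tensor iff all two-party marginals of its
Choi state are maximally mixed. -/
def PerfectTensor {X : Type*} [Fintype X] [DecidableEq X]
    (U : Matrix (X × X) (X × X) ℂ) : Prop :=
  rhoAB (choiVec U) = mmState (X × X) ∧ rhoAC (choiVec U) = mmState (X × X) ∧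
  rhoAD (choiVec U) = mmState (X × X) ∧ rhoBC (choiVec U) = mmState (X × X) ∧
  rhoBD (choiVec U) = mmState (X × X) ∧ rhoCD (choiVec U) = mmState (X × X)

/-- The unitary `U_d` which acts as `U_S` on the subspace spanned by the first `d_S`
basis vectors of each tensor factor, and as the identity otherwise. -/
def embedU (dS d : ℕ) (h : dS ≤ d) (US : Matrix (Fin dS × Fin dS) (Fin dS × Fin dS) ℂ) :
    Matrix (Fin d × Fin d) (Fin d × Fin d) ℂ :=
  Matrix.of fun o i =>
    if hi : i.1.val < dS ∧ i.2.val < dS then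
      if ho : o.1.val < dS ∧ o.2.val < dS then
        US (⟨o.1.val, ho.1⟩, ⟨o.2.val, ho.2⟩) (⟨i.1.val, hi.1⟩, ⟨i.2.val, hi.2⟩)
      else 0
    else if o = i then 1 else 0


theorem pinsker_scalar {x : ℝ} (hx : 0 < x) :
    3 * (x - 1) ^ 2 ≤ (2 * x + 4) * (x * Real.log x - x + 1) := by
  set g : ℝ → ℝ := fun x => x * Real.log x - x + 1 - 3 / 2 * (x - 4 + 9 * (x + 2)⁻¹) with hg
  set g' : ℝ → ℝ := fun x => Real.log x - 3 / 2 * (1 - 9 * ((x + 2) ^ 2)⁻¹) with hg'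
  have d1 : ∀ x : ℝ, 0 < x → HasDerivAt g (g' x) x := by
    intro x hx
    have h2 : x + 2 ≠ 0 := by positivity
    have h := ((((Real.hasDerivAt_mul_log hx.ne').sub (hasDerivAt_id x)).add_const 1).sub
      ((((hasDerivAt_id x).sub_const 4).add
        ((((hasDerivAt_id x).add_const 2).inv h2).const_mul 9)).const_mul (3 / 2)))
    refine h.congr_deriv ?_
    simp only [hg', id]
    field_simp
    ring
  have d2 : ∀ x : ℝ, 0 < x → HasDerivAt g' (x⁻¹ - 27 * ((x + 2) ^ 3)⁻¹) x := by
    intro x hx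
    have h2 : (x + 2) ^ 2 ≠ 0 := by positivity
    have h := (Real.hasDerivAt_log hx.ne').sub
      ((((((hasDerivAt_id x).add_const 2).pow 2).inv h2).const_mul 9).const_sub 1 |>.const_mul (3 / 2))
    refine h.congr_deriv ?_
    simp only [id]
    have : x + 2 ≠ 0 := by positivity
    simp
    field_simp
    ring
  have m : MonotoneOn g' (Set.Ioi 0) := by
    refine monotoneOn_of_deriv_nonneg (convex_Ioi 0)
      (fun x hx => (d2 x hx).continuousAt.continuousWithinAt)
      (fun x hx => ?_) (fun x hx => ?_)
    · rw [interior_Ioi] at hx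
      exact (d2 x hx).differentiableAt.differentiableWithinAt
    · rw [interior_Ioi] at hx
      rw [(d2 x hx).deriv]
      have hx : 0 < x := hx
      rw [sub_nonneg, ← div_eq_mul_inv, inv_eq_one_div, div_le_div_iff₀ (by positivity) hx]
      nlinarith [mul_nonneg (sq_nonneg (x - 1)) (by linarith : (0:ℝ) ≤ x + 8)]
  have g'1 : g' 1 = 0 := by simp only [hg']; norm_num
  have g1 : g 1 = 0 := by simp only [hg]; norm_num
  have key : 0 ≤ g x := by
    rcases le_total 1 x with h | h
    · have : MonotoneOn g (Set.Ici 1) := by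
        refine monotoneOn_of_deriv_nonneg (convex_Ici 1)
          (fun x hx => (d1 x (lt_of_lt_of_le one_pos hx)).continuousAt.continuousWithinAt)
          (fun x hx => ?_) (fun x hx => ?_)
        · rw [interior_Ici] at hx
          exact (d1 x (one_pos.trans hx)).differentiableAt.differentiableWithinAt
        · rw [interior_Ici] at hx
          rw [(d1 x (one_pos.trans hx)).deriv, ← g'1]
          exact m (Set.mem_Ioi.2 one_pos) (Set.mem_Ioi.2 (one_pos.trans hx)) (le_of_lt hx)
      rw [← g1]
      exact this (Set.mem_Ici.2 le_rfl) h h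
    · have : AntitoneOn g (Set.Ioc 0 1) := by
        refine antitoneOn_of_deriv_nonpos (convex_Ioc 0 1)
          (fun x hx => (d1 x hx.1).continuousAt.continuousWithinAt)
          (fun x hx => ?_) (fun x hx => ?_)
        · rw [interior_Ioc] at hx
          exact (d1 x hx.1).differentiableAt.differentiableWithinAt
        · rw [interior_Ioc] at hx
          rw [(d1 x hx.1).deriv, ← g'1]
          exact m (Set.mem_Ioi.2 hx.1) (Set.mem_Ioi.2 one_pos) hx.2.le
      rw [← g1]
      exact this ⟨hx, h⟩ ⟨one_pos, le_rfl⟩ h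
  have e : (2 * x + 4) * g x = (2 * x + 4) * (x * Real.log x - x + 1) - 3 * (x - 1) ^ 2 := by
    simp only [hg]
    have : x + 2 ≠ 0 := by positivity
    field_simp
    ring
  have := mul_nonneg (by positivity : 0 ≤ 2 * x + 4) key
  linarith

theorem pinsker_scalar' {x : ℝ} (hx : 0 ≤ x) :
    3 * (x - 1) ^ 2 ≤ (2 * x + 4) * (x * Real.log x - x + 1) := by
  rcases hx.eq_or_lt with rfl | h
  · norm_num
  · exact pinsker_scalar h

/-- Classical Pinsker against the uniform distribution. -/
theorem pinsker_unif {ι : Type*} [Fintype ι] (p : ι → ℝ) (hp : ∀ i, 0 ≤ p i)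
    (hs : ∑ i, p i = 1) (q : ℝ) (hq : 0 < q) (hqn : (Fintype.card ι : ℝ) * q = 1) :
    (∑ i, |p i - q|) ^ 2 ≤ 2 * (-Real.log q - ∑ i, Real.negMulLog (p i)) := by
  set k : ι → ℝ := fun i => p i * Real.log (p i / q) - p i + q with hk
  have hpt : ∀ i, 3 * (p i - q) ^ 2 ≤ (2 * p i + 4 * q) * k i := by
    intro i
    have := pinsker_scalar' (div_nonneg (hp i) hq.le)
    have h2 := mul_le_mul_of_nonneg_left this (sq_nonneg q)
    have e1 : q ^ 2 * (3 * (p i / q - 1) ^ 2) = 3 * (p i - q) ^ 2 := by field_simp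
    have e2 : q ^ 2 * ((2 * (p i / q) + 4) * (p i / q * Real.log (p i / q) - p i / q + 1))
      = (2 * p i + 4 * q) * k i := by simp only [hk]; field_simp
    rwa [e1, e2] at h2
  have hk0 : ∀ i, 0 ≤ k i := by
    intro i
    have h1 : 0 ≤ (2 * p i + 4 * q) * k i := le_trans (by positivity) (hpt i)
    have := hp i
    exact nonneg_of_mul_nonneg_right h1 (by positivity)
  have cs : (∑ i, |p i - q|) ^ 2 ≤ (∑ i, (2 * p i + 4 * q) / 3) * ∑ i, k i := by
    refine Finset.sum_sq_le_sum_mul_sum_of_sq_le_mul _ ?_ ?_ ?_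
    · intro i _; have := hp i; positivity
    · intro i _; exact hk0 i
    · intro i _
      rw [sq_abs]
      linarith [hpt i]
  have s1 : ∑ i, (2 * p i + 4 * q) / 3 = 2 := by
    rw [← Finset.sum_div, Finset.sum_add_distrib, ← Finset.mul_sum, hs, Finset.sum_const,
      Finset.card_univ, nsmul_eq_mul]
    linarith
  have s2 : ∑ i, k i = -Real.log q - ∑ i, Real.negMulLog (p i) := by
    have : ∀ i, k i = - Real.negMulLog (p i) - p i * Real.log q - p i + q := by
      intro i
      simp only [hk, Real.negMulLog]
      rcases (hp i).eq_or_lt with h | h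
      · simp [← h]
      · rw [Real.log_div h.ne' hq.ne']; ring
    simp_rw [this]
    rw [Finset.sum_add_distrib, Finset.sum_sub_distrib, Finset.sum_sub_distrib,
      Finset.sum_neg_distrib, ← Finset.sum_mul, hs, Finset.sum_const,
      Finset.card_univ, nsmul_eq_mul, hqn]
    ring
  rwa [s1, s2] at cs

theorem eig_sum_of_diag {n : Type*} [Fintype n] [DecidableEq n] {X : Matrix n n ℂ}
    (hX : X.IsHermitian) (V : unitary (Matrix n n ℂ)) (f : n → ℝ)
    (h : X = (V : Matrix n n ℂ) * diagonal (fun i => (f i : ℂ)) * star (V : Matrix n n ℂ))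
    (F : ℝ → ℝ) : ∑ i, F (hX.eigenvalues i) = ∑ i, F (f i) := by
  have hc : X.charpoly = (diagonal (fun i => (f i : ℂ))).charpoly := by
    rw [h, Matrix.charpoly_mul_comm, ← mul_assoc]
    simp
  have hr := hX.roots_charpoly_eq_eigenvalues
  rw [hc, Matrix.charpoly_diagonal] at hr
  have hr2 : (∏ i, (Polynomial.X - Polynomial.C (f i : ℂ))).roots
      = Multiset.map (fun i => (f i : ℂ)) Finset.univ.val := by
    rw [← Polynomial.roots_multiset_prod_X_sub_C (Multiset.map (fun i => (f i : ℂ)) Finset.univ.val),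
      Multiset.map_map]
    rfl
  rw [hr2] at hr
  have h2 := congrArg (fun s => (s.map (fun z : ℂ => F z.re)).sum) hr
  simp only [Multiset.map_map] at h2
  simpa using h2.symm

theorem traceNorm_sub {n : Type*} [Fintype n] [DecidableEq n] {ρ : Matrix n n ℂ}
    (hρ : ρ.IsHermitian) (q : ℝ) :
    traceNorm (ρ - (q : ℂ) • 1) = ∑ i, |hρ.eigenvalues i - q| := by
  set V := hρ.eigenvectorUnitary
  have hs : ρ = (V : Matrix n n ℂ) * diagonal (fun i => (hρ.eigenvalues i : ℂ))
      * star (V : Matrix n n ℂ) := by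
    have := hρ.spectral_theorem
    rw [Unitary.conjStarAlgAut_apply] at this
    exact this
  have hV : star (V : Matrix n n ℂ) * (V : Matrix n n ℂ) = 1 := by simp
  have hV' : (V : Matrix n n ℂ) * star (V : Matrix n n ℂ) = 1 := by simp
  have hX : ρ - (q : ℂ) • 1 = (V : Matrix n n ℂ) *
      diagonal (fun i => ((hρ.eigenvalues i - q : ℝ) : ℂ)) * star (V : Matrix n n ℂ) := by
    have : diagonal (fun i => ((hρ.eigenvalues i - q : ℝ) : ℂ)) =
      diagonal (fun i => (hρ.eigenvalues i : ℂ)) - (q : ℂ) • (1 : Matrix n n ℂ) := by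
      rw [smul_one_eq_diagonal, diagonal_sub]
      push_cast
      rfl
    rw [this, mul_sub, sub_mul, ← hs, mul_smul_comm, mul_one, smul_mul_assoc, hV']
  have hXX : (ρ - (q : ℂ) • 1)ᴴ * (ρ - (q : ℂ) • 1) = (V : Matrix n n ℂ) *
      diagonal (fun i => (((hρ.eigenvalues i - q) ^ 2 : ℝ) : ℂ)) * star (V : Matrix n n ℂ) := by
    have hh : (ρ - (q : ℂ) • 1)ᴴ = ρ - (q : ℂ) • 1 := by
      rw [conjTranspose_sub, hρ.eq, conjTranspose_smul]; simp
    rw [hh, hX]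
    have : diagonal (fun i => (((hρ.eigenvalues i - q) ^ 2 : ℝ) : ℂ)) =
      diagonal (fun i => ((hρ.eigenvalues i - q : ℝ) : ℂ)) *
      diagonal (fun i => ((hρ.eigenvalues i - q : ℝ) : ℂ)) := by
      rw [diagonal_mul_diagonal]
      congr 1; ext i; push_cast; ring
    rw [this]
    simp only [mul_assoc]
    rw [← mul_assoc (star (V : Matrix n n ℂ)), hV, one_mul]
  unfold traceNorm
  rw [eig_sum_of_diag _ V _ hXX Real.sqrt]
  simp [Real.sqrt_sq_eq_abs]

theorem sum_eig {n : Type*} [Fintype n] [DecidableEq n] {ρ : Matrix n n ℂ}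
    (hρ : ρ.IsHermitian) (ht : ρ.trace = 1) : ∑ i, hρ.eigenvalues i = 1 := by
  have := hρ.trace_eq_sum_eigenvalues
  rw [ht] at this
  have h2 := congrArg Complex.re this
  simpa using h2.symm

theorem vNE_flat {n : Type*} [Fintype n] [DecidableEq n] {ρ : Matrix n n ℂ}
    (hρ : ρ.IsHermitian) (ht : ρ.trace = 1) (q : ℝ)
    (h : ρ * ρ = (q : ℂ) • ρ) : vNE ρ = -Real.logb 2 q := by
  have he : ∀ i, hρ.eigenvalues i * hρ.eigenvalues i = q * hρ.eigenvalues i := by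
    intro i
    have h1 := hρ.mulVec_eigenvectorBasis i
    set v := hρ.eigenvectorBasis i with hv
    have hv0 : (v : n → ℂ) ≠ 0 := by
      intro h0
      have := hρ.eigenvectorBasis.orthonormal.ne_zero i
      apply this
      ext j
      exact congrFun h0 j
    have h2 : (ρ * ρ) *ᵥ (v : n → ℂ) = ((q : ℂ) • ρ) *ᵥ (v : n → ℂ) := by rw [h]
    rw [← mulVec_mulVec, h1, mulVec_smul, h1, smul_mulVec, h1] at h2
    obtain ⟨j, hj⟩ := Function.ne_iff.1 hv0
    have h3 := congrFun h2 j
    simp only [Pi.smul_apply, Complex.real_smul, smul_eq_mul] at h3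
    have h4 : ((hρ.eigenvalues i : ℂ) * hρ.eigenvalues i - q * hρ.eigenvalues i) * v j = 0 := by
      linear_combination h3
    rcases mul_eq_zero.1 h4 with h5 | h5
    · have := sub_eq_zero.1 h5
      exact_mod_cast this
    · exact absurd h5 hj
  rw [vNE, dif_pos hρ]
  have : ∀ i, Real.negMulLog (hρ.eigenvalues i) = -Real.log q * hρ.eigenvalues i := by
    intro i
    by_cases h0 : hρ.eigenvalues i = 0
    · simp [h0]
    · have := mul_right_cancel₀ h0 (he i)
      rw [this, Real.negMulLog]; ring
  simp_rw [this]
  rw [← Finset.mul_sum, sum_eig hρ ht, Real.logb]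
  ring

theorem vNE_scalar {n : Type*} [Fintype n] [DecidableEq n] [Nonempty n] :
    vNE (mmState n) = Real.logb 2 (Fintype.card n) := by
  have h0 : (Fintype.card n : ℂ) ≠ 0 := by
    exact_mod_cast Fintype.card_ne_zero
  have : mmState n = (((Fintype.card n : ℝ)⁻¹ : ℝ) : ℂ) • 1 := by simp [mmState]
  rw [vNE_flat (q := (Fintype.card n : ℝ)⁻¹), Real.logb_inv, neg_neg]
  · rw [this, Matrix.IsHermitian, conjTranspose_smul]; simp
  · rw [mmState, trace_smul, trace_one]; simp [h0]
  · rw [this]; simp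

theorem redDM_eq {X Y : Type*} [Fintype Y] (ψ : X × Y → ℂ) :
    redDM ψ = (Matrix.of fun x y => ψ (x, y)) * (Matrix.of fun x y => ψ (x, y))ᴴ := by
  ext x x'
  simp [redDM, Matrix.mul_apply]

theorem redDM_psd {X Y : Type*} [Fintype X] [Fintype Y] (ψ : X × Y → ℂ) :
    (redDM ψ).PosSemidef := by
  rw [redDM_eq]; exact posSemidef_self_mul_conjTranspose _

/-- Pinsker for a state against the maximally mixed state. -/
theorem pinsker_mm {n : Type*} [Fintype n] [DecidableEq n] [Nonempty n] {ρ : Matrix n n ℂ}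
    (hρ : ρ.PosSemidef) (ht : ρ.trace = 1) :
    traceNorm (ρ - mmState n) ^ 2 ≤
      2 * Real.log 2 * (Real.logb 2 (Fintype.card n) - vNE ρ) := by
  have hc : (0 : ℝ) < Fintype.card n := by exact_mod_cast Fintype.card_pos
  have : mmState n = (((Fintype.card n : ℝ)⁻¹ : ℝ) : ℂ) • 1 := by simp [mmState]
  rw [this, traceNorm_sub hρ.1, vNE, dif_pos hρ.1]
  have h := pinsker_unif hρ.1.eigenvalues hρ.eigenvalues_nonneg (sum_eig hρ.1 ht)
    (Fintype.card n : ℝ)⁻¹ (by positivity) (by field_simp)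
  refine h.trans (le_of_eq ?_)
  have : Real.log 2 ≠ 0 := (Real.log_pos one_lt_two).ne'
  rw [Real.log_inv, Real.logb]
  field_simp

section choi
variable {a b c d : ℕ}

theorem s_sq (ha : 0 < a) (hb : 0 < b) :
    ((Real.sqrt ((a:ℝ) * b) : ℂ)⁻¹) * ((Real.sqrt ((a:ℝ) * b) : ℂ)⁻¹) = ((a : ℂ) * b)⁻¹ := by
  rw [← mul_inv]
  congr 1
  have : Real.sqrt ((a:ℝ) * b) * Real.sqrt ((a:ℝ) * b) = a * b := Real.mul_self_sqrt (by positivity)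
  exact_mod_cast this

theorem choi_mul (ha : 0 < a) (hb : 0 < b) (U : Matrix (Fin c × Fin d) (Fin a × Fin b) ℂ) (p q) :
    choiVec U p * star (choiVec U q) = ((a : ℂ) * b)⁻¹ * (U p.2 p.1 * star (U q.2 q.1)) := by
  rw [← s_sq ha hb]
  simp [choiVec]
  ring

theorem cols (U : Matrix (Fin c × Fin d) (Fin a × Fin b) ℂ) (hU : IsUnitaryMat U) (x y) :
    ∑ k, ∑ l, U (k, l) x * star (U (k, l) y) = if x = y then 1 else 0 := by
  have h := congrFun (congrFun hU.2 y) x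
  simp only [Matrix.mul_apply, Fintype.sum_prod_type, conjTranspose_apply, one_apply] at h
  simp_rw [mul_comm (U _ x), eq_comm (a := x)]
  exact h

theorem rows (U : Matrix (Fin c × Fin d) (Fin a × Fin b) ℂ) (hU : IsUnitaryMat U) (x y) :
    ∑ k, ∑ l, U x (k, l) * star (U y (k, l)) = if x = y then 1 else 0 := by
  have h := congrFun (congrFun hU.1 x) y
  simpa only [Matrix.mul_apply, Fintype.sum_prod_type, conjTranspose_apply, one_apply] using h

theorem sum3 {R S T : Type*} [Fintype R] [Fintype S] [Fintype T] (f : R → S → T → ℂ) :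
    ∑ i, ∑ j, ∑ k, f i j k = ∑ k, ∑ i, ∑ j, f i j k := by
  rw [Finset.sum_comm (s := (Finset.univ : Finset T))]
  refine Finset.sum_congr rfl fun i _ => ?_
  exact Finset.sum_comm

theorem rhoA_eq (ha : 0 < a) (hb : 0 < b)
    (U : Matrix (Fin c × Fin d) (Fin a × Fin b) ℂ) (hU : IsUnitaryMat U) :
    rhoA (choiVec U) = mmState (Fin a) := by
  ext x y
  simp only [rhoA, redDM, of_apply, choi_mul ha hb, ← Finset.mul_sum, Fintype.sum_prod_type,
    cols U hU, mmState, Matrix.smul_apply, one_apply]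
  have : (a : ℂ) ≠ 0 := by exact_mod_cast ha.ne'
  have : (b : ℂ) ≠ 0 := by exact_mod_cast hb.ne'
  by_cases h : x = y <;> simp [h]
  field_simp

theorem rhoC_eq (ha : 0 < a) (hb : 0 < b) (hc : 0 < c) (hd : 0 < d) (hdim : a * b = c * d)
    (U : Matrix (Fin c × Fin d) (Fin a × Fin b) ℂ) (hU : IsUnitaryMat U) :
    rhoC (choiVec U) = mmState (Fin c) := by
  ext x y
  simp only [rhoC, redDM, of_apply, choi_mul ha hb, ← Finset.mul_sum, Fintype.sum_prod_type,
    mmState, Matrix.smul_apply, one_apply]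
  rw [sum3]
  simp only [rows U hU]
  have h1 : (c : ℂ) ≠ 0 := by exact_mod_cast hc.ne'
  have h2 : (d : ℂ) ≠ 0 := by exact_mod_cast hd.ne'
  have h3 : (a : ℂ) * b = c * d := by exact_mod_cast hdim
  rw [h3]
  by_cases h : x = y <;> simp [h]
  field_simp

theorem rhoD_eq (ha : 0 < a) (hb : 0 < b) (hc : 0 < c) (hd : 0 < d) (hdim : a * b = c * d)
    (U : Matrix (Fin c × Fin d) (Fin a × Fin b) ℂ) (hU : IsUnitaryMat U) :
    rhoD (choiVec U) = mmState (Fin d) := by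
  ext x y
  simp only [rhoD, redDM, of_apply, choi_mul ha hb, ← Finset.mul_sum, Fintype.sum_prod_type,
    mmState, Matrix.smul_apply, one_apply]
  rw [sum3]
  simp only [rows U hU]
  have h1 : (c : ℂ) ≠ 0 := by exact_mod_cast hc.ne'
  have h2 : (d : ℂ) ≠ 0 := by exact_mod_cast hd.ne'
  have h3 : (a : ℂ) * b = c * d := by exact_mod_cast hdim
  rw [h3]
  by_cases h : x = y <;> simp [h]
  field_simp

theorem rhoCD_eq (ha : 0 < a) (hb : 0 < b) (hdim : a * b = c * d)
    (U : Matrix (Fin c × Fin d) (Fin a × Fin b) ℂ) (hU : IsUnitaryMat U) :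
    rhoCD (choiVec U) = mmState (Fin c × Fin d) := by
  ext x y
  simp only [rhoCD, redDM, of_apply, choi_mul ha hb, ← Finset.mul_sum, Fintype.sum_prod_type,
    mmState, Matrix.smul_apply, one_apply]
  have h3 : (a : ℂ) * b = c * d := by exact_mod_cast hdim
  rw [rows U hU, h3]
  by_cases h : x = y <;> simp [h]

theorem SACD_eq (ha : 0 < a) (hb : 0 < b)
    (U : Matrix (Fin c × Fin d) (Fin a × Fin b) ℂ) (hU : IsUnitaryMat U) :
    SACD (choiVec U) = Real.logb 2 b := by
  have h1 : (a : ℂ) ≠ 0 := by exact_mod_cast ha.ne'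
  have h2 : (b : ℂ) ≠ 0 := by exact_mod_cast hb.ne'
  set M : Matrix (Fin a × Fin c × Fin d) (Fin b) ℂ :=
    Matrix.of fun p j => choiVec U ((p.1, j), p.2) with hM
  have hr : rhoACD (choiVec U) = M * Mᴴ := by
    rw [rhoACD, redDM_eq]
  have hMM : Mᴴ * M = (((b : ℝ)⁻¹ : ℝ) : ℂ) • (1 : Matrix (Fin b) (Fin b) ℂ) := by
    ext i j
    simp only [Matrix.mul_apply, conjTranspose_apply, hM, of_apply, Matrix.smul_apply, one_apply]
    simp_rw [mul_comm (star _), choi_mul ha hb]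
    simp only [← Finset.mul_sum, Fintype.sum_prod_type, cols U hU]
    by_cases h : i = j
    · simp [h]; field_simp
    · simp [h, Ne.symm h]
  rw [SACD, vNE_flat (q := (b : ℝ)⁻¹), Real.logb_inv, neg_neg]
  · exact (redDM_psd _).1
  · rw [hr, trace_mul_comm, hMM, trace_smul, trace_one]; simp [h2]
  · rw [hr, Matrix.mul_assoc M, ← Matrix.mul_assoc Mᴴ, hMM, Matrix.smul_mul, Matrix.one_mul,
      Matrix.mul_smul]

theorem traceAC (ha : 0 < a) (hb : 0 < b)
    (U : Matrix (Fin c × Fin d) (Fin a × Fin b) ℂ) (hU : IsUnitaryMat U) :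
    (rhoAC (choiVec U)).trace = 1 := by
  have h1 : (a : ℂ) ≠ 0 := by exact_mod_cast ha.ne'
  have h2 : (b : ℂ) ≠ 0 := by exact_mod_cast hb.ne'
  simp only [Matrix.trace, diag_apply, rhoAC, redDM, of_apply, choi_mul ha hb, ← Finset.mul_sum,
    Fintype.sum_prod_type]
  have : ∀ x : Fin a, ∑ k, ∑ j, ∑ l, U (k, l) (x, j) * star (U (k, l) (x, j)) = b := by
    intro x
    rw [Finset.sum_comm]
    simp only [cols U hU]
    simp
  simp only [this]
  simp
  field_simp

theorem traceAD (ha : 0 < a) (hb : 0 < b)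
    (U : Matrix (Fin c × Fin d) (Fin a × Fin b) ℂ) (hU : IsUnitaryMat U) :
    (rhoAD (choiVec U)).trace = 1 := by
  have h1 : (a : ℂ) ≠ 0 := by exact_mod_cast ha.ne'
  have h2 : (b : ℂ) ≠ 0 := by exact_mod_cast hb.ne'
  simp only [Matrix.trace, diag_apply, rhoAD, redDM, of_apply, choi_mul ha hb, ← Finset.mul_sum,
    Fintype.sum_prod_type]
  have : ∀ x : Fin a, ∑ l, ∑ j, ∑ k, U (k, l) (x, j) * star (U (k, l) (x, j)) = b := by
    intro x
    rw [← sum3 fun j k l => U (k, l) (x, j) * star (U (k, l) (x, j))]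
    simp only [cols U hU]
    simp
  simp only [this]
  simp
  field_simp

end choi

theorem vNE_zero {n : Type*} [Fintype n] [DecidableEq n] {ρ : Matrix n n ℂ} (h : ρ = 0) :
    vNE ρ = 0 := by
  subst h
  have hh : (0 : Matrix n n ℂ).IsHermitian := isHermitian_zero
  rw [vNE, dif_pos hh, hh.eigenvalues_eq_zero_iff.2 rfl]
  simp

/-- If the Choi state of `U_{AB→CD}` satisfies
`I₃(A;C;D) = -2 log₂|A| + ε` with `|A|` smallest, then `I(A;D) ≤ ε`, `I(A;C) ≤ ε`, and the
reduced Choi states on `AD` and `AC` are within trace distance `√(2 ln(2) ε)` of maximally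
mixed. -/
theorem approx_maximal_scrambling_decouples (a b c d : ℕ) (hdim : a * b = c * d)
    (U : Matrix (Fin c × Fin d) (Fin a × Fin b) ℂ) (hU : IsUnitaryMat U)
    (ε : ℝ) (hε : 0 ≤ ε)
    (hsmall : a ≤ b ∧ a ≤ c ∧ a ≤ d)
    (hI3 : I3ACD (choiVec U) = -2 * Real.logb 2 a + ε) :
    IAD (choiVec U) ≤ ε ∧ IAC (choiVec U) ≤ ε ∧
    traceNorm (rhoAD (choiVec U) - mmState (Fin a × Fin d)) ≤
      Real.sqrt (2 * Real.log 2 * ε) ∧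
    traceNorm (rhoAC (choiVec U) - mmState (Fin a × Fin c)) ≤
      Real.sqrt (2 * Real.log 2 * ε) := by
  obtain ⟨h1, h2, h3⟩ := hsmall
  rcases Nat.eq_zero_or_pos a with rfl | ha
  · have sA : SA (choiVec U) = 0 := vNE_zero (by ext i; exact i.elim0)
    have sAC : SAC (choiVec U) = 0 := vNE_zero (by ext i; exact i.1.elim0)
    have sAD : SAD (choiVec U) = 0 := vNE_zero (by ext i; exact i.1.elim0)
    have sACD : SACD (choiVec U) = 0 := vNE_zero (by ext i; exact i.1.elim0)
    have sC : SC (choiVec U) = 0 := vNE_zero (by ext i j; simp [rhoC, redDM])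
    have sD : SD (choiVec U) = 0 := vNE_zero (by ext i j; simp [rhoD, redDM])
    have sCD : SCD (choiVec U) = 0 := vNE_zero (by ext i j; simp [rhoCD, redDM])
    simp only [IAC, IAD, IACD, I3ACD, sA, sAC, sAD, sACD, sC, sD, sCD] at hI3 ⊢
    refine ⟨by linarith, by linarith, ?_, ?_⟩ <;>
    · refine le_trans (le_of_eq ?_) (Real.sqrt_nonneg _)
      unfold traceNorm
      exact Finset.sum_eq_zero fun i _ => i.1.elim0
  have hb := ha.trans_le h1
  have hc := ha.trans_le h2
  have hd := ha.trans_le h3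
  haveI : Nonempty (Fin a) := ⟨⟨0, ha⟩⟩
  haveI : Nonempty (Fin c) := ⟨⟨0, hc⟩⟩
  haveI : Nonempty (Fin d) := ⟨⟨0, hd⟩⟩
  have ra : (a : ℝ) ≠ 0 := by exact_mod_cast ha.ne'
  have rb : (b : ℝ) ≠ 0 := by exact_mod_cast hb.ne'
  have rc : (c : ℝ) ≠ 0 := by exact_mod_cast hc.ne'
  have rd : (d : ℝ) ≠ 0 := by exact_mod_cast hd.ne'
  have hl : Real.logb 2 a + Real.logb 2 b = Real.logb 2 c + Real.logb 2 d := by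
    rw [← Real.logb_mul ra rb, ← Real.logb_mul rc rd]
    congr 1
    exact_mod_cast hdim
  have sA : SA (choiVec U) = Real.logb 2 a := by
    rw [SA, rhoA_eq ha hb U hU, vNE_scalar, Fintype.card_fin]
  have sC : SC (choiVec U) = Real.logb 2 c := by
    rw [SC, rhoC_eq ha hb hc hd hdim U hU, vNE_scalar, Fintype.card_fin]
  have sD : SD (choiVec U) = Real.logb 2 d := by
    rw [SD, rhoD_eq ha hb hc hd hdim U hU, vNE_scalar, Fintype.card_fin]
  have sCD : SCD (choiVec U) = Real.logb 2 c + Real.logb 2 d := by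
    rw [SCD, rhoCD_eq ha hb hdim U hU, vNE_scalar, Fintype.card_prod, Fintype.card_fin,
      Fintype.card_fin, Nat.cast_mul, Real.logb_mul rc rd]
  have sACD := SACD_eq ha hb U hU
  have pAC : traceNorm (rhoAC (choiVec U) - mmState (Fin a × Fin c)) ^ 2 ≤
      2 * Real.log 2 * IAC (choiVec U) := by
    have h := pinsker_mm (redDM_psd _) (traceAC ha hb U hU)
    rw [Fintype.card_prod, Fintype.card_fin, Fintype.card_fin, Nat.cast_mul,
      Real.logb_mul ra rc] at h
    rw [IAC, sA, sC]
    exact h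
  have pAD : traceNorm (rhoAD (choiVec U) - mmState (Fin a × Fin d)) ^ 2 ≤
      2 * Real.log 2 * IAD (choiVec U) := by
    have h := pinsker_mm (redDM_psd _) (traceAD ha hb U hU)
    rw [Fintype.card_prod, Fintype.card_fin, Fintype.card_fin, Nat.cast_mul,
      Real.logb_mul ra rd] at h
    rw [IAD, sA, sD]
    exact h
  have l2 : 0 < 2 * Real.log 2 := by have := Real.log_pos one_lt_two; positivity
  have nAC : 0 ≤ IAC (choiVec U) :=
    nonneg_of_mul_nonneg_right ((sq_nonneg _).trans pAC) l2
  have nAD : 0 ≤ IAD (choiVec U) :=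
    nonneg_of_mul_nonneg_right ((sq_nonneg _).trans pAD) l2
  have hsum : IAC (choiVec U) + IAD (choiVec U) = ε := by
    rw [I3ACD, IACD, sA, sCD, sACD] at hI3
    linarith
  have iAD : IAD (choiVec U) ≤ ε := by linarith
  have iAC : IAC (choiVec U) ≤ ε := by linarith
  exact ⟨iAD, iAC,
    Real.le_sqrt_of_sq_le (pAD.trans (mul_le_mul_of_nonneg_left iAD l2.le)),
    Real.le_sqrt_of_sq_le (pAC.trans (mul_le_mul_of_nonneg_left iAC l2.le))⟩

end Scrambling

end
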